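/- arXiv:1911.13223 — 2 statements merged into one kernel-verified Lean document; each statement's English description precedes it below -/
import Mathlib

section
/- Let p₁ = (t, a₃t³ + O(t⁴)) (an inflection point at the origin) and p₂ = (s, b₀ + b₁s + b₂s² + b₃s³ + O(s⁴)) with b₀b₁ ≠ 0 be points of a plane curve with non-parallel tangents. Then the Affine Envelope of Intermediate Lines (AEIL) is regular at s = 0 if and only if b₃ ≠ 0; equivalently, along the parametrization t = [αb₃/((α−1)a₃)]s + O(s²) of the solvability locus, the envelope has the form F(s,α) = (−b₀/b₁ + â s + O(s²), b̂ s + O(s²)) with â·b̂ = 36αb₃²b₀⁴/(b₁⁵(α−1)²). -/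
open Real

/-- `det2 u v` is the determinant of the 2×2 matrix with columns `u` and `v`. -/
noncomputable def det2 (u v : ℝ × ℝ) : ℝ := u.1 * v.2 - u.2 * v.1

/-- The intermediate-line function for the pair of graph points `p₁ = (t, f t)`,
`p₂ = (s, g s)`, written via the Euclidean-normal pairings `N_i(U) = [(1, h′), U]`
(which define the same lines as the co-normals). -/
noncomputable def interLineN (f g : ℝ → ℝ) (α t s : ℝ) (X : ℝ × ℝ) : ℝ :=
  (1 - α) * det2 (1, deriv g s) ((s, g s) - (t, f t))
      * det2 (1, deriv f t) (X - ((1 - α) • ((t : ℝ), f t) + α • ((s : ℝ), g s)))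
    + α * det2 (1, deriv f t) ((s, g s) - (t, f t))
      * det2 (1, deriv g s) (X - ((1 - α) • ((t : ℝ), f t) + α • ((s : ℝ), g s)))

/-- A smooth map with injective differential at `z` admits a globally smooth local section along
any line through its value at `z`. -/
theorem exists_contDiff_curve_of_injective_fderiv {V : Type*} [NormedAddCommGroup V]
    [NormedSpace ℝ V] [FiniteDimensional ℝ V] {Φ : V → V} (hΦ : ContDiff ℝ (⊤ : ℕ∞) Φ) {z : V}
    (hinj : ∀ w, fderiv ℝ Φ z w = 0 → w = 0) (v : V) :
    ∃ γ : ℝ → V, ContDiff ℝ (⊤ : ℕ∞) γ ∧ γ 0 = z ∧ ∀ᶠ s in nhds (0 : ℝ), Φ (γ s) = Φ z + s • v := by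
  have : CompleteSpace V := FiniteDimensional.complete ℝ V
  have hker : (fderiv ℝ Φ z).ker = ⊥ := (LinearMap.ker_eq_bot').2 hinj
  let L : V ≃L[ℝ] V :=
    (LinearEquiv.ofInjectiveEndo (fderiv ℝ Φ z : V →ₗ[ℝ] V)
      (LinearMap.ker_eq_bot.1 hker)).toContinuousLinearEquiv
  have hL : (L : V →L[ℝ] V) = fderiv ℝ Φ z := by
    ext w
    rfl
  have hstrict : HasStrictFDerivAt Φ (L : V →L[ℝ] V) z := by
    rw [hL]
    exact hΦ.contDiffAt.hasStrictFDerivAt (by simp)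
  let e := hstrict.toOpenPartialHomeomorph Φ
  have heΦ : (e : V → V) = Φ := rfl
  have hz : z ∈ e.source := hstrict.mem_toOpenPartialHomeomorph_source
  have hez : e.symm (Φ z) = z := e.left_inv hz
  have hzt : Φ z ∈ e.target := e.map_source hz
  have hcont : Continuous fun s : ℝ => Φ z + s • v := by fun_prop
  have h0 : Φ z + (0 : ℝ) • v = Φ z := by simp
  have hrange : ∀ᶠ y in nhds z, fderiv ℝ Φ y ∈ Set.range ((↑) : (V ≃L[ℝ] V) → V →L[ℝ] V) :=
    (hΦ.continuous_fderiv (by simp)).continuousAt.eventually_mem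
      (by rw [← hL]; exact ContinuousLinearEquiv.nhds L)
  have hsymm : ∀ᶠ y in nhds (Φ z), y ∈ e.target ∧ ContDiffAt ℝ (⊤ : ℕ∞) e.symm y := by
    have hc : Filter.Tendsto e.symm (nhds (Φ z)) (nhds z) := by
      have := (e.continuousAt_symm hzt).tendsto
      rwa [hez] at this
    filter_upwards [e.open_target.mem_nhds hzt, hc.eventually hrange] with y hy hyr
    obtain ⟨L', hL'⟩ := hyr
    refine ⟨hy, e.contDiffAt_symm (f₀' := L') hy ?_ hΦ.contDiffAt⟩
    rw [hL']
    exact (hΦ.differentiable (by simp) _).hasFDerivAt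
  have hline : ∀ᶠ s in nhds (0 : ℝ),
      Φ z + s • v ∈ e.target ∧ ContDiffAt ℝ (⊤ : ℕ∞) e.symm (Φ z + s • v) := by
    have hc := hcont.tendsto 0
    rw [h0] at hc
    exact hc.eventually hsymm
  obtain ⟨ε, hε, hball⟩ := Metric.eventually_nhds_iff.1 hline
  let χ : ContDiffBump (0 : ℝ) := ⟨ε / 4, ε / 2, by positivity, by linarith⟩
  have hχ : ∀ s : ℝ, dist (χ s * s) 0 < ε := by
    intro s
    rw [dist_zero_right, norm_mul, Real.norm_of_nonneg χ.nonneg]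
    by_cases hs : ‖s‖ < ε / 2
    · nlinarith [χ.le_one (x := s), χ.nonneg (x := s), norm_nonneg s]
    · rw [χ.zero_of_le_dist (by simpa using hs)]
      simpa using hε
  refine ⟨fun s : ℝ => e.symm (Φ z + (χ s * s) • v), ?_, ?_, ?_⟩
  · rw [contDiff_iff_contDiffAt]
    intro s
    have hin : ContDiffAt ℝ (⊤ : ℕ∞) (fun s : ℝ => Φ z + (χ s * s) • v) s :=
      contDiffAt_const.add (((χ.contDiff (n := (⊤ : ℕ∞))).mul contDiff_id).smul contDiff_const).contDiffAt
    exact (hball (hχ s)).2.comp s hin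
  · simpa using hez
  · filter_upwards [χ.eventuallyEq_one] with s hs
    have h1 := e.right_inv (hball (hχ s)).1
    rw [heΦ] at h1
    rw [h1, hs]
    simp

/-- The derivative of `interLineN f g α t s X` in `s`. -/
noncomputable def interLineDs (f g : ℝ → ℝ) (α s t x y : ℝ) : ℝ :=
  -((1 - α) * deriv (deriv g) s * (s - t) * (y - f t - deriv f t * (x - t)))
    + α * (deriv g s - deriv f t) * (y - g s - deriv g s * (x - s))
    - α * (g s - f t - deriv f t * (s - t)) * deriv (deriv g) s * (x - s)

/-- The derivative of `interLineN f g α t s X` in `t`. -/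
noncomputable def interLineDt (f g : ℝ → ℝ) (α s t x y : ℝ) : ℝ :=
  (1 - α) * (deriv g s - deriv f t) * (y - f t - deriv f t * (x - t))
    - (1 - α) * (g s - f t - deriv g s * (s - t)) * deriv (deriv f) t * (x - t)
    - α * deriv (deriv f) t * (s - t) * (y - g s - deriv g s * (x - s))

theorem interLineN_eq (f g : ℝ → ℝ) (α t s : ℝ) (X : ℝ × ℝ) :
    interLineN f g α t s X =
      (1 - α) * (g s - f t - deriv g s * (s - t)) * (X.2 - f t - deriv f t * (X.1 - t))
        + α * (g s - f t - deriv f t * (s - t)) * (X.2 - g s - deriv g s * (X.1 - s)) := by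
  simp only [interLineN, det2, Prod.fst_sub, Prod.snd_sub, Prod.fst_add, Prod.snd_add,
    Prod.smul_fst, Prod.smul_snd, smul_eq_mul]
  ring

section

variable {f g : ℝ → ℝ}

theorem hasDerivAt_interLineN_right (hg : Differentiable ℝ g) (hg' : Differentiable ℝ (deriv g))
    (α t s : ℝ) (X : ℝ × ℝ) :
    HasDerivAt (fun s' => interLineN f g α t s' X) (interLineDs f g α s t X.1 X.2) s := by
  simp only [interLineN_eq]
  have h0 := (hg s).hasDerivAt
  have h1 := (hg' s).hasDerivAt
  have hi := hasDerivAt_id' s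
  have hP := (h0.sub_const (f t)).sub (h1.mul (hi.sub_const t))
  have hQ := (h0.sub_const (f t)).sub ((hi.sub_const t).const_mul (deriv f t))
  have hB := (h0.const_sub X.2).sub (h1.mul (hi.const_sub X.1))
  have h := ((hP.const_mul (1 - α)).mul_const (X.2 - f t - deriv f t * (X.1 - t))).add
    ((hQ.const_mul α).mul hB)
  refine h.congr_deriv ?_
  simp only [interLineDs, Pi.sub_apply, Pi.mul_apply]
  ring

theorem hasDerivAt_interLineN_left (hf : Differentiable ℝ f) (hf' : Differentiable ℝ (deriv f))
    (α t s : ℝ) (X : ℝ × ℝ) :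
    HasDerivAt (fun t' => interLineN f g α t' s X) (interLineDt f g α s t X.1 X.2) t := by
  simp only [interLineN_eq]
  have h0 := (hf t).hasDerivAt
  have h1 := (hf' t).hasDerivAt
  have hi := hasDerivAt_id' t
  have hP := (h0.const_sub (g s)).sub ((hi.const_sub s).const_mul (deriv g s))
  have hQ := (h0.const_sub (g s)).sub (h1.mul (hi.const_sub s))
  have hA := (h0.const_sub X.2).sub (h1.mul (hi.const_sub X.1))
  have h := ((hP.const_mul (1 - α)).mul hA).add
    ((hQ.const_mul α).mul_const (X.2 - g s - deriv g s * (X.1 - s)))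
  refine h.congr_deriv ?_
  simp only [interLineDt, Pi.sub_apply, Pi.mul_apply]
  ring

/-- First-order behaviour, along a curve through the base point, of the three equations that
define the envelope. -/
theorem hasDerivAt_envelope_equations {α a₃ b₀ b₁ b₃ r : ℝ} {s t x y : ℝ → ℝ} {s' t' x' y' : ℝ}
    (hf : HasDerivAt f 0 0) (hf' : HasDerivAt (deriv f) 0 0)
    (hf'' : HasDerivAt (deriv (deriv f)) (6 * a₃) 0)
    (hg : HasDerivAt g b₁ 0) (hg' : HasDerivAt (deriv g) 0 0)
    (hg'' : HasDerivAt (deriv (deriv g)) (6 * b₃) 0)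
    (hf0 : f 0 = 0) (hg0 : g 0 = b₀) (hb₁ : b₁ ≠ 0)
    (hs : HasDerivAt s s' r) (ht : HasDerivAt t t' r) (hx : HasDerivAt x x' r)
    (hy : HasDerivAt y y' r)
    (hs0 : s r = 0) (ht0 : t r = 0) (hx0 : x r = -b₀ / b₁) (hy0 : y r = 0) :
    HasDerivAt (fun u => interLineN f g α (t u) (s u) (x u, y u))
      (b₀ * y' - α * b₀ * b₁ * x') r ∧
    HasDerivAt (fun u => interLineDs f g α (s u) (t u) (x u) (y u))
      (α * b₁ * (y' - b₁ * x') + 6 * α * b₃ * b₀ ^ 2 / b₁ * s') r ∧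
    HasDerivAt (fun u => interLineDt f g α (s u) (t u) (x u) (y u))
      ((1 - α) * b₁ * y' + 6 * (1 - α) * a₃ * b₀ ^ 2 / b₁ * t') r := by
  have hf1 := hf.deriv
  have hf2 := hf'.deriv
  have hg1 := hg.deriv
  have hg2 := hg'.deriv
  rw [← ht0] at hf hf' hf''
  rw [← hs0] at hg hg' hg''
  have f0 := hf.comp r ht
  have f1 := hf'.comp r ht
  have f2 := hf''.comp r ht
  have g0 := hg.comp r hs
  have g1 := hg'.comp r hs
  have g2 := hg''.comp r hs
  have hP := (g0.sub f0).sub (g1.mul (hs.sub ht))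
  have hQ := (g0.sub f0).sub (f1.mul (hs.sub ht))
  have hA := (hy.sub f0).sub (f1.mul (hx.sub ht))
  have hB := (hy.sub g0).sub (g1.mul (hx.sub hs))
  refine ⟨?_, ?_, ?_⟩
  · simp only [interLineN_eq]
    refine (((hP.const_mul (1 - α)).mul hA).add ((hQ.const_mul α).mul hB)).congr_deriv ?_
    simp only [Pi.sub_apply, Pi.mul_apply, Function.comp_apply, hs0, ht0, hx0, hy0, hf0, hg0,
      hf1, hg1]
    field_simp
    ring
  · simp only [interLineDs]
    refine ((((((g2.const_mul (1 - α)).mul (hs.sub ht)).mul hA).neg).add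
      (((g1.sub f1).const_mul α).mul hB)).sub
      (((hQ.const_mul α).mul g2).mul (hx.sub hs))).congr_deriv ?_
    simp only [Pi.sub_apply, Pi.mul_apply, Function.comp_apply, hs0, ht0, hx0, hy0, hf0, hg0,
      hf1, hg1, hg2]
    field_simp
    ring
  · simp only [interLineDt]
    refine (((((g1.sub f1).const_mul (1 - α)).mul hA).sub
      (((hP.const_mul (1 - α)).mul f2).mul (hx.sub ht))).sub
      (((f2.const_mul α).mul (hs.sub ht)).mul hB)).congr_deriv ?_
    simp only [Pi.sub_apply, Pi.mul_apply, Function.comp_apply, hs0, ht0, hx0, hy0, hf0, hg0,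
      hf1, hf2, hg1]
    field_simp
    ring

end

/-- For `p₁ = (t, a₃t³ + ⋯)` an inflection point and `p₂ = (s, b₀ + b₁s + b₃s³ + ⋯)`
with `b₀b₁ ≠ 0` and non-parallel tangents, the Affine Envelope of Intermediate Lines,
parametrized along the solvability locus `t = [αb₃/((α−1)a₃)]s + O(s²)`, has the form
`E(s) = (−b₀/b₁ + âs + O(s²), b̂s + O(s²))` with
`â·b̂ = 36αb₃²b₀⁴/(b₁⁵(α−1)²)`; in particular it is regular at `s = 0` iff `b₃ ≠ 0`. -/
theorem stmt14 (f g : ℝ → ℝ) (α a₃ b₀ b₁ b₃ : ℝ)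
    (hf : ContDiff ℝ (⊤ : ℕ∞) f) (hg : ContDiff ℝ (⊤ : ℕ∞) g)
    (hα : α ∈ Set.Ioo (0:ℝ) 1)
    (hf0 : f 0 = 0) (hf1 : deriv f 0 = 0) (hf2 : iteratedDeriv 2 f 0 = 0)
    (ha₃ : a₃ = iteratedDeriv 3 f 0 / 6) (ha₃ne : a₃ ≠ 0)
    (hg0 : g 0 = b₀) (hg1 : deriv g 0 = b₁) (hg2 : iteratedDeriv 2 g 0 = 0)
    (hb₃ : b₃ = iteratedDeriv 3 g 0 / 6)
    (hb : b₀ * b₁ ≠ 0) :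
    ∃ (τ : ℝ → ℝ) (E : ℝ → ℝ × ℝ), ContDiff ℝ (⊤ : ℕ∞) τ ∧ ContDiff ℝ (⊤ : ℕ∞) E ∧
      τ 0 = 0 ∧ deriv τ 0 = α * b₃ / ((α - 1) * a₃) ∧
      (∀ᶠ s in nhds (0:ℝ),
        interLineN f g α (τ s) s (E s) = 0 ∧
        deriv (fun s' => interLineN f g α (τ s) s' (E s)) s = 0 ∧
        deriv (fun t' => interLineN f g α t' s (E s)) (τ s) = 0) ∧
      E 0 = (-b₀/b₁, 0) ∧
      deriv (fun s => (E s).1) 0 * deriv (fun s => (E s).2) 0 =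
        36 * α * b₃^2 * b₀^4 / (b₁^5 * (α - 1)^2) ∧
      (deriv E 0 ≠ 0 ↔ b₃ ≠ 0) := by
  obtain ⟨hα0, hα1⟩ := hα
  have hb₀ : b₀ ≠ 0 := left_ne_zero_of_mul hb
  have hb₁ : b₁ ≠ 0 := right_ne_zero_of_mul hb
  have hα0' : α ≠ 0 := hα0.ne'
  have hα1' : 1 - α ≠ 0 := by linarith
  have hα1'' : α - 1 ≠ 0 := by linarith
  have hf' : ContDiff ℝ (⊤ : ℕ∞) (deriv f) := (contDiff_infty_iff_deriv.1 hf).2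
  have hf'' : ContDiff ℝ (⊤ : ℕ∞) (deriv (deriv f)) := (contDiff_infty_iff_deriv.1 hf').2
  have hg' : ContDiff ℝ (⊤ : ℕ∞) (deriv g) := (contDiff_infty_iff_deriv.1 hg).2
  have hg'' : ContDiff ℝ (⊤ : ℕ∞) (deriv (deriv g)) := (contDiff_infty_iff_deriv.1 hg').2
  have df := hf.differentiable (by simp)
  have df' := hf'.differentiable (by simp)
  have df'' := hf''.differentiable (by simp)
  have dg := hg.differentiable (by simp)
  have dg' := hg'.differentiable (by simp)
  have dg'' := hg''.differentiable (by simp)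
  simp only [iteratedDeriv_succ, iteratedDeriv_zero] at hf2 hg2 ha₃ hb₃
  have key := fun {r : ℝ} {s t x y : ℝ → ℝ} {s' t' x' y' : ℝ} =>
    hasDerivAt_envelope_equations (f := f) (g := g) (α := α) (a₃ := a₃) (b₀ := b₀) (b₁ := b₁)
      (b₃ := b₃) (r := r) (s := s) (t := t) (x := x) (y := y) (s' := s') (t' := t') (x' := x')
      (y' := y')
      ((df 0).hasDerivAt.congr_deriv hf1)
      ((df' 0).hasDerivAt.congr_deriv hf2)
      ((df'' 0).hasDerivAt.congr_deriv (by linarith))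
      ((dg 0).hasDerivAt.congr_deriv hg1)
      ((dg' 0).hasDerivAt.congr_deriv hg2)
      ((dg'' 0).hasDerivAt.congr_deriv (by linarith))
      hf0 hg0 hb₁
  let Φ : ℝ × ℝ × ℝ × ℝ → ℝ × ℝ × ℝ × ℝ := fun z =>
    (z.1, interLineN f g α z.2.1 z.1 (z.2.2.1, z.2.2.2),
      interLineDs f g α z.1 z.2.1 z.2.2.1 z.2.2.2, interLineDt f g α z.1 z.2.1 z.2.2.1 z.2.2.2)
  have hΦ : ContDiff ℝ (⊤ : ℕ∞) Φ := by
    simp only [Φ, interLineN_eq, interLineDs, interLineDt]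
    fun_prop
  let z : ℝ × ℝ × ℝ × ℝ := (0, 0, -b₀ / b₁, 0)
  have hΦz : Φ z = 0 := by
    simp only [Φ, z, interLineN_eq, interLineDs, interLineDt, hf0, hf1, hf2, hg0, hg1, hg2,
      Prod.mk_eq_zero]
    refine ⟨trivial, ?_, ?_, ?_⟩ <;> field_simp <;> ring
  have hinj : ∀ w, fderiv ℝ Φ z w = 0 → w = 0 := by
    rintro ⟨s', t', x', y'⟩ hw
    have hlin : ∀ c d : ℝ, HasDerivAt (fun h : ℝ => c + h * d) d 0 := fun c d => by
      simpa using ((hasDerivAt_id' (0 : ℝ)).mul_const d).const_add c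
    have hcurve : HasDerivAt (fun h : ℝ => (0 + h * s', 0 + h * t', -b₀ / b₁ + h * x', 0 + h * y'))
        (s', t', x', y') 0 :=
      (hlin _ _).prodMk ((hlin _ _).prodMk ((hlin _ _).prodMk (hlin _ _)))
    have hcomp := HasFDerivAt.comp_hasDerivAt_of_eq (0 : ℝ)
      (hΦ.differentiable (by simp) z).hasFDerivAt hcurve (by simp [z])
    rw [hw] at hcomp
    obtain ⟨k1, k2, k3⟩ := key (hlin 0 s') (hlin 0 t') (hlin (-b₀ / b₁) x') (hlin 0 y')
      (by simp) (by simp) (by simp) (by simp)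
    have huniq := hcomp.unique ((hlin 0 s').prodMk (k1.prodMk (k2.prodMk k3)))
    simp only [Prod.ext_iff, Prod.fst_zero, Prod.snd_zero] at huniq
    obtain ⟨e0, e1, e2, e3⟩ := huniq
    subst e0
    have h1 : y' = α * b₁ * x' := mul_left_cancel₀ hb₀ (by linarith)
    have h2 : y' = b₁ * x' := mul_left_cancel₀ (mul_ne_zero hα0' hb₁) (by linarith)
    have hx' : x' = 0 := by
      have : (1 - α) * b₁ * x' = 0 := by linarith
      simpa [hα1', hb₁] using this
    have hy' : y' = 0 := by simp [h2, hx']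
    have ht' : t' = 0 := by
      rw [hy'] at e3
      field_simp at e3
      simpa [hα1', hb₀, ha₃ne] using e3
    simp [hx', hy', ht']
  obtain ⟨γ, hγ, hγ0, hγe⟩ := exists_contDiff_curve_of_injective_fderiv hΦ hinj (1, 0, 0, 0)
  simp only [hΦz] at hγe
  have hτ : ContDiff ℝ (⊤ : ℕ∞) fun s => (γ s).2.1 := hγ.snd.fst
  have hx : ContDiff ℝ (⊤ : ℕ∞) fun s => (γ s).2.2.1 := hγ.snd.snd.fst
  have hy : ContDiff ℝ (⊤ : ℕ∞) fun s => (γ s).2.2.2 := hγ.snd.snd.snd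
  have heq : ∀ᶠ s in nhds (0 : ℝ),
      interLineN f g α (γ s).2.1 s ((γ s).2.2.1, (γ s).2.2.2) = 0 ∧
      interLineDs f g α s (γ s).2.1 (γ s).2.2.1 (γ s).2.2.2 = 0 ∧
      interLineDt f g α s (γ s).2.1 (γ s).2.2.1 (γ s).2.2.2 = 0 := by
    filter_upwards [hγe] with s hs
    simp only [Φ, Prod.ext_iff, zero_add, Prod.smul_fst, Prod.smul_snd, smul_eq_mul, mul_one,
      mul_zero] at hs
    obtain ⟨h0, h1, h2, h3⟩ := hs
    rw [h0] at h1 h2 h3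
    exact ⟨h1, h2, h3⟩
  have dτ := (hτ.differentiable (by simp) 0).hasDerivAt
  have dx := (hx.differentiable (by simp) 0).hasDerivAt
  have dy := (hy.differentiable (by simp) 0).hasDerivAt
  set t' := deriv (fun s => (γ s).2.1) 0
  set x' := deriv (fun s => (γ s).2.2.1) 0
  set y' := deriv (fun s => (γ s).2.2.2) 0
  obtain ⟨k1, k2, k3⟩ := key (hasDerivAt_id' (0 : ℝ)) dτ dx dy rfl (by simp [hγ0, z])
    (by simp [hγ0, z]) (by simp [hγ0, z])
  have zero_of : ∀ {φ : ℝ → ℝ} {c : ℝ}, HasDerivAt φ c 0 → (∀ᶠ s in nhds (0 : ℝ), φ s = 0) →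
      c = 0 := fun hφ h0 =>
    hφ.unique ((hasDerivAt_const (0 : ℝ) (0 : ℝ)).congr_of_eventuallyEq h0)
  have e1 := zero_of k1 (heq.mono fun s h => h.1)
  have e2 := zero_of k2 (heq.mono fun s h => h.2.1)
  have e3 := zero_of k3 (heq.mono fun s h => h.2.2)
  have h1 : y' = α * b₁ * x' := mul_left_cancel₀ hb₀ (by linarith)
  have hx' : x' = 6 * b₃ * b₀ ^ 2 / (b₁ ^ 3 * (1 - α)) := by
    rw [h1] at e2
    field_simp at e2 ⊢
    exact mul_left_cancel₀ hα0' (by linarith)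
  have hy' : y' = 6 * α * b₃ * b₀ ^ 2 / (b₁ ^ 2 * (1 - α)) := by
    rw [h1, hx']
    field_simp
  have ht' : t' = α * b₃ / ((α - 1) * a₃) := by
    rw [hy'] at e3
    rw [eq_div_iff (mul_ne_zero hα1'' ha₃ne)]
    field_simp at e3
    exact mul_left_cancel₀ (by positivity : 6 * b₀ ^ 2 ≠ 0) (by linarith)
  refine ⟨fun s => (γ s).2.1, fun s => (γ s).2.2, hτ, hγ.snd.snd, by simp [hγ0, z], ht', ?_,
    by simp [hγ0, z], ?_, ?_⟩
  · filter_upwards [heq] with s hs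
    exact ⟨hs.1, (hasDerivAt_interLineN_right dg dg' _ _ _ _).deriv.trans hs.2.1,
      (hasDerivAt_interLineN_left df df' _ _ _ _).deriv.trans hs.2.2⟩
  · change x' * y' = _
    rw [hx', hy', show (α - 1) ^ 2 = (1 - α) ^ 2 by ring]
    field_simp
    ring
  · have dE : HasDerivAt (fun s => (γ s).2.2) (x', y') 0 := dx.prodMk dy
    rw [dE.deriv, hx', hy', not_iff_not, Prod.mk_eq_zero]
    simp [hα0', hα1', hb₀, hb₁]
end

section
/- Let p₁ = (t, (1/2)t² + a₃t³ + a₄t⁴ + O(t⁵)) and p₂ = (s, b₀ + b₂s² + b₃s³ + b₄s⁴ + O(s⁵)) (so b₁ = 0, tangent lines parallel) with b₀ > 0, a₃ > 0, α ∈ (0,1). The Intermediate-Parallel Tangent Locus (IPTL) of the pair passes through M_α(0,0) = (0, b₀α); it is regular at s = 0 iff b₂ ≠ α/(2(α−1)); it has an ordinary cusp at s = 0 iff b₂ = α/(2(α−1)) and b₃ ≠ (α/(α−1))²a₃; and it has a (3,4)-cusp at s = 0 iff b₂ = α/(2(α−1)), b₃ = (α/(α−1))²a₃, and b₄ ≠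 (α/(α−1))³a₄. -/
open Real

open Filter Topology in
/-- A function that is smooth near a point agrees near that point with a globally smooth one. -/
theorem exists_contDiff_eventuallyEq {φ : ℝ → ℝ} {b : ℝ}
    (hφ : ∀ᶠ x in 𝓝 b, ContDiffAt ℝ (⊤ : ℕ∞) φ x) :
    ∃ ψ : ℝ → ℝ, ContDiff ℝ (⊤ : ℕ∞) ψ ∧ ψ =ᶠ[𝓝 b] φ := by
  obtain ⟨r, hr, hball⟩ := Metric.eventually_nhds_iff_ball.1 hφ
  let c : ContDiffBump b := ⟨r / 4, r / 2, by positivity, by linarith⟩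
  refine ⟨fun x => c x * φ x, contDiff_iff_contDiffAt.2 fun x => ?_, ?_⟩
  · by_cases hx : x ∈ Metric.ball b r
    · exact c.contDiff.contDiffAt.mul (hball x hx)
    · have hx' : x ∉ tsupport c := by
        rw [c.tsupport_eq]
        intro h
        exact hx (Metric.closedBall_subset_ball (by change r / 2 < r; linarith) h)
      refine (contDiffAt_const (c := (0 : ℝ))).congr_of_eventuallyEq ?_
      filter_upwards [notMem_tsupport_iff_eventuallyEq.1 hx'] with y hy
      simp [hy]
  · filter_upwards [c.eventuallyEq_one] with y hy
    simp [hy]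

open Filter Topology in
/-- Near a point where `F' ≠ 0`, the equation `F (τ s) = G s` has a smooth solution `τ`. -/
theorem exists_contDiff_solution {F G : ℝ → ℝ} {a b : ℝ}
    (hF : ContDiff ℝ (⊤ : ℕ∞) F) (hG : ContDiff ℝ (⊤ : ℕ∞) G)
    (hab : F a = G b) (hFa : deriv F a ≠ 0) :
    ∃ τ : ℝ → ℝ, ContDiff ℝ (⊤ : ℕ∞) τ ∧ τ b = a ∧ ∀ᶠ s in 𝓝 b, F (τ s) = G s := by
  have hd : ∀ x, HasDerivAt F (deriv F x) x := fun x =>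
    (hF.differentiable (by simp) x).hasDerivAt
  have hn : ((⊤ : ℕ∞) : WithTop ℕ∞) ≠ 0 := by simp
  let e := hF.contDiffAt.toOpenPartialHomeomorph F ((hd a).hasFDerivAt_equiv hFa) hn
  have he : ∀ x, e x = F x := fun _ => rfl
  have hasrc : a ∈ e.source :=
    hF.contDiffAt.mem_toOpenPartialHomeomorph_source ((hd a).hasFDerivAt_equiv hFa) hn
  have hbt : G b ∈ e.target := by
    rw [← hab, ← he]
    exact e.map_source hasrc
  have hsymm : e.symm (G b) = a := by
    rw [← hab, ← he]
    exact e.left_inv hasrc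
  have hev : ∀ᶠ s in 𝓝 b, G s ∈ e.target :=
    hG.continuous.continuousAt.eventually (e.open_target.mem_nhds hbt)
  have hcont : ContinuousAt (fun s => deriv F (e.symm (G s))) b := by
    refine (hF.continuous_deriv (by simp)).continuousAt.comp ?_
    exact (e.continuousAt_symm hbt).comp hG.continuous.continuousAt
  have hne : ∀ᶠ s in 𝓝 b, deriv F (e.symm (G s)) ≠ 0 :=
    hcont.eventually_ne (by simpa [hsymm] using hFa)
  obtain ⟨τ, hτ, hτe⟩ := exists_contDiff_eventuallyEq (φ := fun s => e.symm (G s)) (b := b) (by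
    filter_upwards [hev, hne] with s hs hs'
    exact (e.contDiffAt_symm_deriv hs' hs (hd _) hF.contDiffAt).comp s hG.contDiffAt)
  refine ⟨τ, hτ, hτe.self_of_nhds.trans hsymm, ?_⟩
  filter_upwards [hτe, hev] with s hs hs'
  rw [hs]
  exact e.right_inv hs'

theorem iteratedDeriv_prodMk {u v : ℝ → ℝ} (hu : ContDiff ℝ (⊤ : ℕ∞) u)
    (hv : ContDiff ℝ (⊤ : ℕ∞) v) (n : ℕ) :
    iteratedDeriv n (fun s => (u s, v s)) =
      fun s => (iteratedDeriv n u s, iteratedDeriv n v s) := by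
  induction n generalizing u v with
  | zero => simp
  | succ n ih =>
    have h : deriv (fun s => (u s, v s)) = fun s => (deriv u s, deriv v s) := by
      ext1 s
      exact ((hu.differentiable (by simp) s).hasDerivAt.prodMk
        (hv.differentiable (by simp) s).hasDerivAt).deriv
    simp only [iteratedDeriv_succ', h]
    exact ih (contDiff_infty_iff_deriv.1 hu).2 (contDiff_infty_iff_deriv.1 hv).2

theorem deriv_comp_mul {F τ : ℝ → ℝ} (hF : Differentiable ℝ F) (hτ : Differentiable ℝ τ) :
    deriv (fun s => F (τ s)) = fun s => deriv F (τ s) * deriv τ s := by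
  ext1 s
  exact ((hF (τ s)).hasDerivAt.comp s (hτ s).hasDerivAt).deriv

theorem deriv_fun_mul_of_differentiable {u v : ℝ → ℝ} (hu : Differentiable ℝ u)
    (hv : Differentiable ℝ v) :
    deriv (fun s => u s * v s) = fun s => deriv u s * v s + u s * deriv v s := by
  ext1 s
  exact deriv_fun_mul (hu s) (hv s)

theorem deriv_fun_add_of_differentiable {u v : ℝ → ℝ} (hu : Differentiable ℝ u)
    (hv : Differentiable ℝ v) :
    deriv (fun s => u s + v s) = fun s => deriv u s + deriv v s := by
  ext1 s
  exact deriv_fun_add (hu s) (hv s)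

open Filter Topology in
/-- The first three derivatives of a solution `τ` of `F (τ s) = G s`. -/
theorem iteratedDeriv_solution {F G τ : ℝ → ℝ} {b : ℝ} (hF : ContDiff ℝ (⊤ : ℕ∞) F)
    (hτ : ContDiff ℝ (⊤ : ℕ∞) τ) (h : (fun s => F (τ s)) =ᶠ[𝓝 b] G) :
    deriv F (τ b) * deriv τ b = deriv G b ∧
    iteratedDeriv 2 F (τ b) * deriv τ b ^ 2 + deriv F (τ b) * iteratedDeriv 2 τ b =
      iteratedDeriv 2 G b ∧
    iteratedDeriv 3 F (τ b) * deriv τ b ^ 3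
        + 3 * iteratedDeriv 2 F (τ b) * deriv τ b * iteratedDeriv 2 τ b
        + deriv F (τ b) * iteratedDeriv 3 τ b = iteratedDeriv 3 G b := by
  have F1 := (contDiff_infty_iff_deriv.1 hF).2
  have F2 := (contDiff_infty_iff_deriv.1 F1).2
  have T1 := (contDiff_infty_iff_deriv.1 hτ).2
  have T2 := (contDiff_infty_iff_deriv.1 T1).2
  have dF := hF.differentiable (by simp)
  have dF1 := F1.differentiable (by simp)
  have dF2 := F2.differentiable (by simp)
  have dT := hτ.differentiable (by simp)
  have dT1 := T1.differentiable (by simp)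
  have dT2 := T2.differentiable (by simp)
  have c1 : Differentiable ℝ (fun s => deriv F (τ s)) := dF1.comp dT
  have c2 : Differentiable ℝ (fun s => deriv (deriv F) (τ s)) := dF2.comp dT
  have e1 : deriv (fun s => F (τ s)) b = deriv G b := h.deriv_eq
  have e2 : deriv (deriv (fun s => F (τ s))) b = deriv (deriv G) b := h.deriv.deriv_eq
  have e3 : deriv (deriv (deriv (fun s => F (τ s)))) b = deriv (deriv (deriv G)) b :=
    h.deriv.deriv.deriv_eq
  have D1 := deriv_comp_mul dF dT
  have D2 : deriv (fun s => deriv F (τ s) * deriv τ s) =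
      fun s => deriv (deriv F) (τ s) * deriv τ s * deriv τ s
        + deriv F (τ s) * deriv (deriv τ) s := by
    rw [deriv_fun_mul_of_differentiable c1 dT1, deriv_comp_mul dF1 dT]
  have D3 : deriv (fun s => deriv (deriv F) (τ s) * deriv τ s * deriv τ s
        + deriv F (τ s) * deriv (deriv τ) s) =
      fun s => ((deriv (deriv (deriv F)) (τ s) * deriv τ s * deriv τ s
        + deriv (deriv F) (τ s) * deriv (deriv τ) s) * deriv τ s
        + deriv (deriv F) (τ s) * deriv τ s * deriv (deriv τ) s)
        + (deriv (deriv F) (τ s) * deriv τ s * deriv (deriv τ) s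
        + deriv F (τ s) * deriv (deriv (deriv τ)) s) := by
    rw [deriv_fun_add_of_differentiable ((c2.fun_mul dT1).fun_mul dT1) (c1.fun_mul dT2),
      deriv_fun_mul_of_differentiable (c2.fun_mul dT1) dT1,
      deriv_fun_mul_of_differentiable c2 dT1, deriv_fun_mul_of_differentiable c1 dT2,
      deriv_comp_mul dF1 dT, deriv_comp_mul dF2 dT]
  rw [D1, D2, D3] at e3
  rw [D1, D2] at e2
  rw [D1] at e1
  simp only [iteratedDeriv_succ', iteratedDeriv_zero]
  exact ⟨e1, by linear_combination e2, by linear_combination e3⟩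

open Filter Topology in
/-- Cuspidal data at `0` of a curve whose velocity is `h • (1, m)` with `m 0 = 0`. -/
theorem iteratedDeriv_of_velocity {θ : ℝ → ℝ × ℝ} {h m : ℝ → ℝ}
    (hh : ContDiff ℝ (⊤ : ℕ∞) h) (hm : ContDiff ℝ (⊤ : ℕ∞) m) (hm0 : m 0 = 0)
    (hθ : deriv θ =ᶠ[𝓝 0] fun s => (h s, h s * m s)) :
    deriv θ 0 = (h 0, 0) ∧
    iteratedDeriv 2 θ 0 = (deriv h 0, h 0 * deriv m 0) ∧
    iteratedDeriv 3 θ 0 = (iteratedDeriv 2 h 0,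
      2 * deriv h 0 * deriv m 0 + h 0 * iteratedDeriv 2 m 0) ∧
    iteratedDeriv 4 θ 0 = (iteratedDeriv 3 h 0,
      3 * iteratedDeriv 2 h 0 * deriv m 0 + 3 * deriv h 0 * iteratedDeriv 2 m 0
        + h 0 * iteratedDeriv 3 m 0) := by
  have key : ∀ n, iteratedDeriv (n + 1) θ 0 =
      (iteratedDeriv n h 0, iteratedDeriv n (fun s => h s * m s) 0) := by
    intro n
    rw [iteratedDeriv_succ', hθ.iteratedDeriv_eq, iteratedDeriv_prodMk hh (hh.mul hm)]
  have cd : ∀ {u : ℝ → ℝ}, ContDiff ℝ (⊤ : ℕ∞) u → ∀ n : ℕ, ContDiffAt ℝ n u 0 :=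
    fun hu n => (hu.of_le (by exact_mod_cast le_top)).contDiffAt
  refine ⟨?_, ?_, ?_, ?_⟩
  · simp [hθ.self_of_nhds, hm0]
  all_goals
    rw [key, iteratedDeriv_fun_mul (cd hh _) (cd hm _)]
    simp [Finset.sum_range_succ, hm0, Nat.choose]
  all_goals ring

/-- For `p₁ = (t, (1/2)t² + a₃t³ + a₄t⁴ + ⋯)` and `p₂ = (s, b₀ + b₂s² + b₃s³ + b₄s⁴ + ⋯)`
with parallel tangent lines (`b₁ = 0`), the Intermediate-Parallel Tangent Locus `θ`
(the envelope of the lines through `M_α` parallel to the common tangent direction,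
over the parallelism locus `t = τ(s)`) passes through `(0, b₀α)`; it is regular at
`s = 0` iff `b₂ ≠ α/(2(α−1))`; it has an ordinary cusp at `s = 0` iff
`b₂ = α/(2(α−1))` and `b₃ ≠ (α/(α−1))²a₃`; and it has a `(3,4)`-cusp at `s = 0` iff
`b₂ = α/(2(α−1))`, `b₃ = (α/(α−1))²a₃` and `b₄ ≠ (α/(α−1))³a₄`. -/
theorem stmt15 (f g : ℝ → ℝ) (α a₃ a₄ b₀ b₂ b₃ b₄ : ℝ)
    (hf : ContDiff ℝ (⊤ : ℕ∞) f) (hg : ContDiff ℝ (⊤ : ℕ∞) g)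
    (hα : α ∈ Set.Ioo (0:ℝ) 1)
    (hf0 : f 0 = 0) (hf1 : deriv f 0 = 0) (hf2 : iteratedDeriv 2 f 0 = 1)
    (ha₃ : a₃ = iteratedDeriv 3 f 0 / 6) (ha₄ : a₄ = iteratedDeriv 4 f 0 / 24)
    (hg0 : g 0 = b₀) (hg1 : deriv g 0 = 0)
    (hb₂ : b₂ = iteratedDeriv 2 g 0 / 2) (hb₃ : b₃ = iteratedDeriv 3 g 0 / 6)
    (hb₄ : b₄ = iteratedDeriv 4 g 0 / 24)
    (hb₀pos : 0 < b₀) (ha₃pos : 0 < a₃) :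
    ∃ (τ : ℝ → ℝ) (θ : ℝ → ℝ × ℝ), ContDiff ℝ (⊤ : ℕ∞) τ ∧ ContDiff ℝ (⊤ : ℕ∞) θ ∧
      τ 0 = 0 ∧
      (∀ᶠ s in nhds (0:ℝ), deriv f (τ s) = deriv g s) ∧
      (∀ᶠ s in nhds (0:ℝ),
        det2 (θ s - ((1 - α) • ((τ s : ℝ), f (τ s)) + α • ((s : ℝ), g s)))
            (1, deriv g s) = 0 ∧
        deriv (fun s' =>
          det2 (θ s - ((1 - α) • ((τ s' : ℝ), f (τ s')) + α • ((s' : ℝ), g s')))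
            (1, deriv g s')) s = 0) ∧
      θ 0 = (0, b₀ * α) ∧
      (deriv θ 0 ≠ 0 ↔ b₂ ≠ α / (2*(α - 1))) ∧
      ((deriv θ 0 = 0 ∧ det2 (iteratedDeriv 2 θ 0) (iteratedDeriv 3 θ 0) ≠ 0) ↔
        (b₂ = α / (2*(α - 1)) ∧ b₃ ≠ (α/(α - 1))^2 * a₃)) ∧
      ((deriv θ 0 = 0 ∧ det2 (iteratedDeriv 2 θ 0) (iteratedDeriv 3 θ 0) = 0 ∧
          det2 (iteratedDeriv 3 θ 0) (iteratedDeriv 4 θ 0) ≠ 0) ↔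
        (b₂ = α / (2*(α - 1)) ∧ b₃ = (α/(α - 1))^2 * a₃ ∧
          b₄ ≠ (α/(α - 1))^3 * a₄)) := by
  obtain ⟨hα0, hα1⟩ := hα
  have F1 := (contDiff_infty_iff_deriv.1 hf).2
  have G1 := (contDiff_infty_iff_deriv.1 hg).2
  have hf2' : deriv (deriv f) 0 = 1 := by simpa [iteratedDeriv_succ'] using hf2
  obtain ⟨τ, hτ, hτ0, hpar⟩ := exists_contDiff_solution F1 G1 (hf1.trans hg1.symm)
    (by rw [hf2']; exact one_ne_zero)
  have T1 := (contDiff_infty_iff_deriv.1 hτ).2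
  obtain ⟨t1, t2, t3⟩ := iteratedDeriv_solution F1 hτ hpar
  simp only [hτ0, hf2', one_mul, ← iteratedDeriv_succ', Nat.reduceAdd] at t1 t2 t3
  rw [show deriv (deriv g) 0 = 2 * b₂ by rw [hb₂]; simp [iteratedDeriv_succ']; ring] at t1
  rw [t1, show iteratedDeriv 3 f 0 = 6 * a₃ by rw [ha₃]; ring,
    show iteratedDeriv 3 g 0 = 6 * b₃ by rw [hb₃]; ring] at t2
  rw [t1, show iteratedDeriv 3 f 0 = 6 * a₃ by rw [ha₃]; ring,
    show iteratedDeriv 4 f 0 = 24 * a₄ by rw [ha₄]; ring,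
    show iteratedDeriv 4 g 0 = 24 * b₄ by rw [hb₄]; ring] at t3
  let θ : ℝ → ℝ × ℝ := fun s => (1 - α) • ((τ s : ℝ), f (τ s)) + α • ((s : ℝ), g s)
  let h : ℝ → ℝ := fun s => (1 - α) * deriv τ s + α
  have hh : ContDiff ℝ (⊤ : ℕ∞) h := (contDiff_const.mul T1).add contDiff_const
  have hθ' : ∀ s, HasDerivAt θ ((1 - α) • (deriv τ s, deriv f (τ s) * deriv τ s)
      + α • ((1 : ℝ), deriv g s)) s := by
    intro s
    have dτ := (hτ.differentiable (by simp) s).hasDerivAt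
    have df := (hf.differentiable (by simp) (τ s)).hasDerivAt
    have dg := (hg.differentiable (by simp) s).hasDerivAt
    exact ((dτ.prodMk (df.comp s dτ)).const_smul (1 - α)).add
      (((hasDerivAt_id s).prodMk dg).const_smul α)
  have hvel : deriv θ =ᶠ[nhds 0] fun s => (h s, h s * deriv g s) := by
    filter_upwards [hpar] with s hs
    rw [(hθ' s).deriv, hs]
    ext <;> simp [h]
    ring
  obtain ⟨d1, d2, d3, d4⟩ := iteratedDeriv_of_velocity hh G1 hg1 hvel
  have hdh : deriv h = fun s => (1 - α) * deriv (deriv τ) s := by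
    ext1 s
    exact (((T1.differentiable (by simp) s).hasDerivAt.const_mul (1 - α)).add_const α).deriv
  have h0 : h 0 = (1 - α) * (2 * b₂) + α := by simp only [h, t1]
  have h1 : deriv h 0 = (1 - α) * iteratedDeriv 2 τ 0 := by
    rw [hdh]; simp [iteratedDeriv_succ']
  have h2 : iteratedDeriv 2 h 0 = (1 - α) * iteratedDeriv 3 τ 0 := by
    rw [iteratedDeriv_succ', hdh, iteratedDeriv_const_mul_field, ← iteratedDeriv_succ',
      ← iteratedDeriv_succ']
  have m1 : deriv (deriv g) 0 = 2 * b₂ := by rw [hb₂]; simp [iteratedDeriv_succ']; ring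
  have hα1' : 1 - α ≠ 0 := by linarith
  have hα1'' : α - 1 ≠ 0 := by linarith
  have hreg : h 0 = 0 ↔ b₂ = α / (2 * (α - 1)) := by
    rw [h0, eq_div_iff (by positivity)]
    constructor <;> intro H <;> linarith
  have hreg' : deriv θ 0 = 0 ↔ b₂ = α / (2 * (α - 1)) := by
    rw [d1, ← hreg]; simp
  have hsq : b₂ = α / (2 * (α - 1)) → α / (α - 1) = 2 * b₂ := by
    intro H; rw [H]; field_simp
  have hb₂ne : b₂ = α / (2 * (α - 1)) → b₂ ≠ 0 := by
    intro H; rw [H]; positivity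
  have hcusp : b₂ = α / (2 * (α - 1)) →
      (det2 (iteratedDeriv 2 θ 0) (iteratedDeriv 3 θ 0) = 0 ↔
        b₃ = (α / (α - 1)) ^ 2 * a₃) := by
    intro H
    rw [d2, d3, hreg.2 H, h1, m1, hsq H]
    have : det2 ((1 - α) * iteratedDeriv 2 τ 0, 0 * (2 * b₂)) (iteratedDeriv 2 h 0,
        2 * ((1 - α) * iteratedDeriv 2 τ 0) * (2 * b₂) + 0 * iteratedDeriv 2 (deriv g) 0) =
        4 * (1 - α) ^ 2 * b₂ * iteratedDeriv 2 τ 0 ^ 2 := by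
      simp only [det2]; ring
    rw [this]
    simp only [mul_eq_zero, pow_eq_zero_iff, ne_eq, OfNat.ofNat_ne_zero, not_false_eq_true,
      hα1', hb₂ne H, false_or]
    constructor <;> intro K <;> linarith
  have hcusp' : b₂ = α / (2 * (α - 1)) → b₃ = (α / (α - 1)) ^ 2 * a₃ →
      (det2 (iteratedDeriv 3 θ 0) (iteratedDeriv 4 θ 0) = 0 ↔
        b₄ = (α / (α - 1)) ^ 3 * a₄) := by
    intro H K
    rw [hsq H] at K ⊢
    have hτ2 : iteratedDeriv 2 τ 0 = 0 := by linarith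
    rw [d3, d4, hreg.2 H, h1, h2, m1, hτ2]
    have : det2 ((1 - α) * iteratedDeriv 3 τ 0, 2 * ((1 - α) * 0) * (2 * b₂)
          + 0 * iteratedDeriv 2 (deriv g) 0) (iteratedDeriv 3 h 0,
        3 * ((1 - α) * iteratedDeriv 3 τ 0) * (2 * b₂)
          + 3 * ((1 - α) * 0) * iteratedDeriv 2 (deriv g) 0
          + 0 * iteratedDeriv 3 (deriv g) 0) =
        6 * (1 - α) ^ 2 * b₂ * iteratedDeriv 3 τ 0 ^ 2 := by
      simp only [det2]; ring
    rw [this]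
    rw [hτ2] at t3
    simp only [mul_eq_zero, pow_eq_zero_iff, ne_eq, OfNat.ofNat_ne_zero, not_false_eq_true,
      hα1', hb₂ne H, false_or]
    constructor <;> intro L <;> linarith
  have hθ : ContDiff ℝ (⊤ : ℕ∞) θ :=
    ((hτ.prodMk (hf.comp hτ)).const_smul (1 - α)).add ((contDiff_id.prodMk hg).const_smul α)
  refine ⟨τ, θ, hτ, hθ, hτ0, hpar, ?_, ?_, not_congr hreg', ?_, ?_⟩
  · filter_upwards [hpar] with s hs
    refine ⟨by simp [θ, det2], ?_⟩
    have dm := (G1.differentiable (by simp) s).hasDerivAt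
    have dX := (hasFDerivAt_fst.comp_hasDerivAt s (hθ' s)).const_sub (θ s).1
    have dY := (hasFDerivAt_snd.comp_hasDerivAt s (hθ' s)).const_sub (θ s).2
    have hD := (dX.mul dm).sub dY
    refine (hD.congr_of_eventuallyEq (.of_forall fun x => ?_)).deriv.trans ?_
    · simp [θ, det2]
    · simp [hs]
      ring
  · simp [θ, hτ0, hf0, hg0, mul_comm]
  · rw [hreg']
    exact and_congr_right fun H => not_congr (hcusp H)
  · rw [hreg']
    refine and_congr_right fun H => ?_
    rw [hcusp H]
    exact and_congr_right fun K => not_congr (hcusp' H K)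
end
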